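/- Let A ∈ 𝓑 be such that u(·;A) is not identically zero, let ν be a probability measure on (X,𝓑) with ν(X\A) > 0, let δ ∈ (0,1), and define the perturbed Markov kernel P^δ(x,·) := (1−δ)·P(x,·) + δ·ν. Then: (a) for every bounded measurable f : X → ℝ, sup_{x∈X} |(P^δ f)(x) − (P f)(x)| ≤ 2δ·sup_{y∈X}|f(y)|; (b) the invariance value function u^δ(·;A) of the kernel P^δ is identically zero; consequently sup_{x∈X} |u(x;A) − u^δ(x;A)| = 1. -/

import Mathlib

open MeasureTheory ProbabilityTheory

variable {X : Type*} [MeasurableSpace X]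

/-- Transition operator: `(Pf)(x) = ∫ f(y) P(x,dy)`. -/
noncomputable def transOp (P : Kernel X X) (f : X → ℝ) : X → ℝ :=
  fun x => ∫ y, f y ∂(P x)

/-- Invariance operator `I_A f = 1_A · (Pf)`. -/
noncomputable def invOp (P : Kernel X X) (A : Set X) (f : X → ℝ) : X → ℝ :=
  A.indicator (transOp P f)

/-- Invariance value functions `u_n(·;A)`. -/
noncomputable def uN (P : Kernel X X) (A : Set X) : ℕ → X → ℝ
  | 0 => A.indicator 1
  | n + 1 => invOp P A (uN P A n)

/-- `u(x;A) = lim_n u_n(x;A)` (the sequence is pointwise nonincreasing). -/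
noncomputable def uFun (P : Kernel X X) (A : Set X) : X → ℝ :=
  fun x => ⨅ n, uN P A n x

/-- Reach-avoid value functions `w_n(·;A,B)`. -/
noncomputable def wN (P : Kernel X X) (A B : Set X) : ℕ → X → ℝ
  | 0 => B.indicator 1
  | n + 1 => fun x => B.indicator 1 x + invOp P (A \ B) (wN P A B n) x

/-- `w(x;A,B) = lim_n w_n(x;A,B)` (the sequence is pointwise nondecreasing, in `[0,1]`). -/
noncomputable def wFun (P : Kernel X X) (A B : Set X) : X → ℝ :=
  fun x => ⨆ n, wN P A B n x

/-- A bounded function. -/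
def BddFun (f : X → ℝ) : Prop := ∃ C : ℝ, ∀ x, |f x| ≤ C

/-- A set `S` is absorbing if `P(x,S) = 1` for all `x ∈ S`. -/
def Absorbing (P : Kernel X X) (S : Set X) : Prop := ∀ x ∈ S, P x S = 1

/-- A set is simple if its only absorbing measurable subset is empty. -/
def Simple (P : Kernel X X) (A : Set X) : Prop :=
  ∀ S ⊆ A, MeasurableSet S → Absorbing P S → S = ∅


section

variable (P : Kernel X X) {A : Set X}

lemma measurable_transOp [IsMarkovKernel P] {f : X → ℝ} (hf : Measurable f) :
    Measurable (transOp P f) :=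
  (hf.stronglyMeasurable.integral_kernel (κ := P)).measurable

lemma measurable_uN [IsMarkovKernel P] (hA : MeasurableSet A) (n : ℕ) : Measurable (uN P A n) := by
  induction n with
  | zero => exact measurable_one.indicator hA
  | succ n ih => exact (measurable_transOp P ih).indicator hA

lemma BddFun.integrable {f : X → ℝ} (hf : BddFun f) (hm : Measurable f) (μ : Measure X)
    [IsFiniteMeasure μ] : Integrable f μ := by
  obtain ⟨C, hC⟩ := hf
  exact Integrable.of_bound hm.aestronglyMeasurable C (ae_of_all _ hC)

lemma uN_mem_Icc [IsMarkovKernel P] (A : Set X) (n : ℕ) (x : X) :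
    uN P A n x ∈ Set.Icc (0 : ℝ) 1 := by
  induction n generalizing x with
  | zero => by_cases hx : x ∈ A <;> simp [uN, hx]
  | succ n ih =>
    by_cases hx : x ∈ A
    · simp only [uN, invOp, hx, Set.indicator_of_mem, transOp]
      refine ⟨integral_nonneg fun y => (ih y).1, ?_⟩
      have := norm_integral_le_of_norm_le_const (μ := P x) (f := uN P A n) (C := 1)
        (ae_of_all _ fun y => by
          rw [Real.norm_eq_abs, abs_of_nonneg (ih y).1]; exact (ih y).2)
      simp only [probReal_univ, mul_one] at this
      exact (le_abs_self _).trans this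
    · simp [uN, invOp, hx]

lemma bddFun_uN [IsMarkovKernel P] (A : Set X) (n : ℕ) : BddFun (uN P A n) :=
  ⟨1, fun x => by
    rw [abs_of_nonneg (uN_mem_Icc P A n x).1]; exact (uN_mem_Icc P A n x).2⟩

lemma integrable_uN [IsMarkovKernel P] (hA : MeasurableSet A) (n : ℕ) (μ : Measure X)
    [IsFiniteMeasure μ] : Integrable (uN P A n) μ :=
  (bddFun_uN P A n).integrable (measurable_uN P hA n) μ

lemma uN_succ_le [IsMarkovKernel P] (hA : MeasurableSet A) (n : ℕ) (x : X) :
    uN P A (n + 1) x ≤ uN P A n x := by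
  induction n generalizing x with
  | zero =>
    by_cases hx : x ∈ A
    · exact (uN_mem_Icc P A 1 x).2.trans (by simp [uN, hx])
    · simp [uN, invOp, hx]
  | succ n ih =>
    exact Set.indicator_le_indicator
      (integral_mono (integrable_uN P hA _ _) (integrable_uN P hA _ _) ih)

lemma bddBelow_range_uN [IsMarkovKernel P] (A : Set X) (x : X) :
    BddBelow (Set.range fun n => uN P A n x) :=
  ⟨0, by rintro _ ⟨n, rfl⟩; exact (uN_mem_Icc P A n x).1⟩

lemma tendsto_uN [IsMarkovKernel P] (hA : MeasurableSet A) (x : X) :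
    Filter.Tendsto (fun n => uN P A n x) Filter.atTop (nhds (uFun P A x)) :=
  tendsto_atTop_ciInf (antitone_nat_of_succ_le fun n => uN_succ_le P hA n x)
    (bddBelow_range_uN P A x)

lemma uFun_le_uN [IsMarkovKernel P] (A : Set X) (n : ℕ) (x : X) : uFun P A x ≤ uN P A n x :=
  ciInf_le (bddBelow_range_uN P A x) n

lemma uFun_mem_Icc [IsMarkovKernel P] (A : Set X) (x : X) : uFun P A x ∈ Set.Icc (0 : ℝ) 1 :=
  ⟨le_ciInf fun n => (uN_mem_Icc P A n x).1,
    (uFun_le_uN P A 0 x).trans (uN_mem_Icc P A 0 x).2⟩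

lemma bddFun_uFun [IsMarkovKernel P] (A : Set X) : BddFun (uFun P A) :=
  ⟨1, fun x => by
    rw [abs_of_nonneg (uFun_mem_Icc P A x).1]; exact (uFun_mem_Icc P A x).2⟩

lemma measurable_uFun [IsMarkovKernel P] (hA : MeasurableSet A) : Measurable (uFun P A) :=
  measurable_of_tendsto_metrizable (measurable_uN P hA)
    (tendsto_pi_nhds.2 fun x => tendsto_uN P hA x)

lemma uFun_eq_zero_of_notMem [IsMarkovKernel P] {x : X} (hx : x ∉ A) : uFun P A x = 0 :=
  le_antisymm ((uFun_le_uN P A 0 x).trans (by simp [uN, hx])) (uFun_mem_Icc P A x).1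

/-- The limit of the invariance value functions is a fixed point of the invariance operator. -/
lemma invOp_uFun [IsMarkovKernel P] (hA : MeasurableSet A) : invOp P A (uFun P A) = uFun P A := by
  ext x
  by_cases hx : x ∈ A
  · have h₁ : Filter.Tendsto (fun n => transOp P (uN P A n) x) Filter.atTop
        (nhds (transOp P (uFun P A) x)) := by
      refine tendsto_integral_of_dominated_convergence (fun _ => (1 : ℝ))
        (fun n => (measurable_uN P hA n).aestronglyMeasurable) (integrable_const _)
        (fun n => ae_of_all _ fun y => ?_) (ae_of_all _ fun y => tendsto_uN P hA y)
      rw [Real.norm_eq_abs, abs_of_nonneg (uN_mem_Icc P A n y).1]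
      exact (uN_mem_Icc P A n y).2
    have h₂ := (tendsto_uN P hA x).comp (Filter.tendsto_add_atTop_nat 1)
    have h₃ : (fun n => transOp P (uN P A n) x) = (fun n => uN P A n x) ∘ fun n => n + 1 := by
      ext n
      simp [uN, invOp, hx]
    rw [h₃] at h₁
    rw [invOp, Set.indicator_of_mem hx]
    exact tendsto_nhds_unique h₁ h₂
  · rw [uFun_eq_zero_of_notMem P hx, invOp, Set.indicator_of_notMem hx]

lemma uFun_le_mul_uN [IsMarkovKernel P] (hA : MeasurableSet A) {M : ℝ}
    (hM : ∀ x, uFun P A x ≤ M) (n : ℕ) (x : X) : uFun P A x ≤ M * uN P A n x := by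
  induction n generalizing x with
  | zero =>
    by_cases hx : x ∈ A
    · simpa [uN, hx] using hM x
    · simp [uFun_eq_zero_of_notMem P hx, uN, hx]
  | succ n ih =>
    by_cases hx : x ∈ A
    · rw [← invOp_uFun P hA]
      simp only [uN, invOp, hx, Set.indicator_of_mem, transOp]
      rw [← integral_const_mul]
      exact integral_mono ((bddFun_uFun P A).integrable (measurable_uFun P hA) _)
        ((integrable_uN P hA n _).const_mul M) ih
    · simp [uFun_eq_zero_of_notMem P hx, uN, invOp, hx]

/-- The invariance value function is either zero or has supremum one. -/
lemma iSup_uFun_eq_one [IsMarkovKernel P] (hA : MeasurableSet A) {x₀ : X}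
    (hx₀ : 0 < uFun P A x₀) : ⨆ x, uFun P A x = 1 := by
  have : Nonempty X := ⟨x₀⟩
  have hbdd : BddAbove (Set.range (uFun P A)) :=
    ⟨1, by rintro _ ⟨x, rfl⟩; exact (uFun_mem_Icc P A x).2⟩
  refine le_antisymm (ciSup_le fun x => (uFun_mem_Icc P A x).2) ?_
  have h : uFun P A x₀ ≤ (⨆ x, uFun P A x) * uFun P A x₀ :=
    ge_of_tendsto' ((tendsto_uN P hA x₀).const_mul _)
      fun n => uFun_le_mul_uN P hA (fun x => le_ciSup hbdd x) n x₀
  exact le_of_mul_le_mul_right (by simpa using h) hx₀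

/-- If one step stays in `A` with probability at most `c < 1`, uniformly in the starting point,
then the invariance value function vanishes. -/
lemma uFun_eq_zero_of_measureReal_le [IsMarkovKernel P] (hA : MeasurableSet A) {c : ℝ}
    (hc0 : 0 ≤ c) (hc1 : c < 1) (hc : ∀ x, (P x).real A ≤ c) (x : X) : uFun P A x = 0 := by
  have key : ∀ n x, uN P A n x ≤ c ^ n * A.indicator 1 x := by
    intro n
    induction n with
    | zero => simp [uN]
    | succ n ih =>
      intro x
      by_cases hx : x ∈ A
      · simp only [uN, invOp, hx, Set.indicator_of_mem, transOp, Pi.one_apply, mul_one]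
        calc ∫ y, uN P A n y ∂P x ≤ ∫ y, c ^ n * A.indicator 1 y ∂P x :=
              integral_mono (integrable_uN P hA n _)
                (((integrable_const (1 : ℝ)).indicator hA).const_mul _) ih
          _ = c ^ n * (P x).real A := by rw [integral_const_mul, integral_indicator_one hA]
          _ ≤ c ^ (n + 1) := by
              rw [pow_succ]
              exact mul_le_mul_of_nonneg_left (hc x) (pow_nonneg hc0 n)
      · simp [uN, invOp, hx]
  refine le_antisymm ?_ (uFun_mem_Icc P A x).1
  have hlim := (tendsto_pow_atTop_nhds_zero_of_lt_one hc0 hc1).mul_const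
    (A.indicator (1 : X → ℝ) x)
  rw [zero_mul] at hlim
  exact le_of_tendsto_of_tendsto' (tendsto_uN P hA x) hlim fun n => key n x

end

/-- let `u(·;A)` be not identically zero, `ν` a probability measure with
`ν(X\A) > 0`, `δ ∈ (0,1)`, and let `P^δ(x,·) = (1−δ)·P(x,·) + δ·ν` be the perturbed kernel.
Then (a) `sup_x |(P^δ f)(x) − (P f)(x)| ≤ 2δ·sup_y |f(y)|` for every bounded measurable `f`,
and (b) the invariance value function `u^δ(·;A)` of `P^δ` is identically zero; consequently
`sup_x |u(x;A) − u^δ(x;A)| = 1`. -/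
theorem stmt9 (P : Kernel X X) [IsMarkovKernel P] (A : Set X) (hA : MeasurableSet A)
    (hnz : ∃ x₀ : X, 0 < uFun P A x₀)
    (ν : Measure X) [IsProbabilityMeasure ν] (hν : 0 < ν Aᶜ)
    (δ : ℝ) (hδ0 : 0 < δ) (hδ1 : δ < 1)
    (Pδ : Kernel X X)
    (hPδ : ∀ x : X, Pδ x = ENNReal.ofReal (1 - δ) • P x + ENNReal.ofReal δ • ν) :
    (∀ f : X → ℝ, Measurable f → BddFun f →
        (⨆ x, |transOp Pδ f x - transOp P f x|) ≤ 2 * δ * ⨆ y, |f y|) ∧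
      (∀ x : X, uFun Pδ A x = 0) ∧
      (⨆ x, |uFun P A x - uFun Pδ A x|) = 1 := by
  obtain ⟨x₀, hx₀⟩ := hnz
  have : Nonempty X := ⟨x₀⟩
  have h1δ : 0 ≤ 1 - δ := by linarith
  have hmarkov : IsMarkovKernel Pδ := ⟨fun x => ⟨by
    rw [hPδ x]
    simp [← ENNReal.ofReal_add h1δ hδ0.le]⟩⟩
  have hzero : ∀ x : X, uFun Pδ A x = 0 := by
    have hνA : ν.real A < 1 := by
      have h := probReal_compl_eq_one_sub (μ := ν) hA
      have hpos : 0 < ν.real Aᶜ := ENNReal.toReal_pos hν.ne' (measure_ne_top _ _)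
      linarith
    have hνA0 : 0 ≤ ν.real A := measureReal_nonneg
    refine uFun_eq_zero_of_measureReal_le Pδ hA (c := (1 - δ) + δ * ν.real A)
      (by positivity) (by nlinarith) fun x => ?_
    have hreal : (Pδ x).real A = (1 - δ) * (P x).real A + δ * ν.real A := by
      rw [hPδ x, measureReal_def, Measure.add_apply, Measure.smul_apply, Measure.smul_apply,
        smul_eq_mul, smul_eq_mul, ENNReal.toReal_add (by finiteness) (by finiteness),
        ENNReal.toReal_mul, ENNReal.toReal_mul, ENNReal.toReal_ofReal h1δ,
        ENNReal.toReal_ofReal hδ0.le, measureReal_def, measureReal_def]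
    rw [hreal]
    have := mul_le_mul_of_nonneg_left (measureReal_le_one (μ := P x) (s := A)) h1δ
    linarith
  refine ⟨fun f hf hb => ciSup_le fun x => ?_, hzero, ?_⟩
  · have hbdd : BddAbove (Set.range fun y => |f y|) := by
      obtain ⟨C, hC⟩ := hb
      exact ⟨C, by rintro _ ⟨y, rfl⟩; exact hC y⟩
    have hint : ∀ μ : Measure X, IsProbabilityMeasure μ → |∫ y, f y ∂μ| ≤ ⨆ y, |f y| := by
      intro μ _
      simpa using norm_integral_le_of_norm_le_const (μ := μ) (f := f)
        (ae_of_all _ fun y => le_ciSup hbdd y)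
    have heq : transOp Pδ f x - transOp P f x = δ * (∫ y, f y ∂ν - ∫ y, f y ∂P x) := by
      simp only [transOp]
      rw [hPδ x, integral_add_measure
        ((hb.integrable hf _).smul_measure ENNReal.ofReal_ne_top)
        ((hb.integrable hf _).smul_measure ENNReal.ofReal_ne_top),
        integral_smul_measure, integral_smul_measure, ENNReal.toReal_ofReal h1δ,
        ENNReal.toReal_ofReal hδ0.le, smul_eq_mul, smul_eq_mul]
      ring
    rw [heq, abs_mul, abs_of_pos hδ0]
    have hsub := abs_sub (∫ y, f y ∂ν) (∫ y, f y ∂P x)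
    nlinarith [hint ν inferInstance, hint (P x) inferInstance]
  · simp only [hzero, sub_zero, abs_of_nonneg (uFun_mem_Icc P A _).1]
    exact iSup_uFun_eq_one P hA hx₀
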